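/- Let ε ∈ (0, 1/2), let K be an integer with ln K ≥ 18, let T be an integer with T ≥ 2·ln K, and set δ = min{ (1/(6ε))·√((ln K)/T), 1/2 }. Let i* be drawn uniformly at random from {1,…,K}, and conditionally on i* let C_{1,T},…,C_{K,T} be independent with C_{i*,T} ~ B(T, 1/2 - ε·δ) and C_{j,T} ~ B(T, 1/2) for j ≠ i*. Then for every (possibly randomized) prediction rule, i.e., every function mapping a realization (C_{1,T},…,C_{K,T}) to a probability distribution over {1,…,K} from which a prediction I_T is drawn, Pr[I_T ≠ i*] ≥ 1/4, where the probability is over i*, the counts, and the prediction rule's randomness. -/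

import Mathlib

open MeasureTheory

/-- Joint law of (uniformly random best action `i*`, independent Bernoulli feedback bits):
the bits of action `i` have parameter `q` when `i = i*` and `1/2` otherwise. -/
noncomputable def jointBitsLaw (K T : ℕ) (q : ℝ) : Measure (Fin K × (Fin K → Fin T → Bool)) :=
  Measure.sum fun x =>
    ((K : ENNReal)⁻¹ *
        ∏ i, ∏ t,
          ENNReal.ofReal
            (if x.2 i t then (if i = x.1 then q else 1 / 2)
              else 1 - (if i = x.1 then q else 1 / 2))) •
      Measure.dirac x

/-- A sum over all bit arrays of a product over the entries factors entrywise. -/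
theorem sum_prod_bits {K T : ℕ} (g : Fin K → Bool → ℝ) :
    ∑ b : Fin K → Fin T → Bool, ∏ i, ∏ t, g i (b i t) = ∏ i, (g i true + g i false) ^ T := by
  have h := Fintype.prod_sum (fun (i : Fin K) (c : Fin T → Bool) => ∏ t, g i (c t))
  rw [← h]
  refine Finset.prod_congr rfl fun i _ => ?_
  have h' := Fintype.prod_sum (fun (_ : Fin T) (c : Bool) => g i c)
  rw [← h']
  simp

/-- The probability of the bit `c` of action `i` when the best action is `a`. -/
noncomputable def bitProb {K : ℕ} (q : ℝ) (a i : Fin K) (c : Bool) : ℝ :=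
  if c then (if i = a then q else 1 / 2) else 1 - (if i = a then q else 1 / 2)

theorem bitProb_nonneg {K : ℕ} {q : ℝ} (h0 : 0 ≤ q) (h1 : q ≤ 1) (a i : Fin K) (c : Bool) :
    0 ≤ bitProb q a i c := by
  unfold bitProb
  split_ifs <;> linarith

/-- The likelihood of a bit array when the best action is `a`. -/
noncomputable def bitsLikelihood {K T : ℕ} (q : ℝ) (a : Fin K) (b : Fin K → Fin T → Bool) : ℝ :=
  ∏ i, ∏ t, bitProb q a i (b i t)

theorem sum_bitsLikelihood {K T : ℕ} (q : ℝ) (a : Fin K) :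
    ∑ b : Fin K → Fin T → Bool, bitsLikelihood q a b = 1 := by
  unfold bitsLikelihood
  rw [sum_prod_bits]
  simp [bitProb]

/-- The chi-square type second moment of the likelihood against fair coins. -/
theorem sum_sq_bitsLikelihood {K T : ℕ} (η : ℝ) (a : Fin K) :
    ∑ b : Fin K → Fin T → Bool, ∏ i, ∏ t, 2 * bitProb (1 / 2 - η) a i (b i t) ^ 2 =
      (1 + 4 * η ^ 2) ^ T := by
  rw [sum_prod_bits fun i c => 2 * bitProb (1 / 2 - η) a i c ^ 2]
  rw [Finset.prod_eq_single a]
  · simp only [bitProb]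
    norm_num
    congr 1
    ring
  · intro i _ hi
    simp [bitProb, hi]
    norm_num
  · simp

theorem bitsLikelihood_le {K T : ℕ} {M : ℝ} (hM : 0 < M) (q : ℝ) (a : Fin K)
    (b : Fin K → Fin T → Bool) :
    bitsLikelihood q a b ≤
      M * (∏ _i : Fin K, ∏ _t : Fin T, (1 / 2 : ℝ)) +
        (∏ i, ∏ t, 2 * bitProb q a i (b i t) ^ 2) / (4 * M) := by
  set u : ℝ := ∏ _i : Fin K, ∏ _t : Fin T, (1 / 2 : ℝ) with hu
  set v : ℝ := ∏ i, ∏ t, 2 * bitProb q a i (b i t) with hv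
  have hu0 : 0 ≤ u := by positivity
  have h1 : bitsLikelihood q a b = u * v := by
    simp only [bitsLikelihood, hu, hv, ← Finset.prod_mul_distrib]
    refine Finset.prod_congr rfl fun i _ => Finset.prod_congr rfl fun t _ => by ring
  have h2 : (∏ i, ∏ t, 2 * bitProb q a i (b i t) ^ 2) = u * v ^ 2 := by
    simp only [sq, hu, hv, ← Finset.prod_mul_distrib]
    refine Finset.prod_congr rfl fun i _ => Finset.prod_congr rfl fun t _ => by ring
  have h3 : M * u + u * v ^ 2 / (4 * M) - u * v = u * (2 * M - v) ^ 2 / (4 * M) := by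
    field_simp
    ring
  have h4 : 0 ≤ u * (2 * M - v) ^ 2 / (4 * M) := by positivity
  rw [h1, h2]
  linarith

/-- Integrals against `jointBitsLaw` are finite weighted sums. -/
theorem integral_jointBitsLaw {K T : ℕ} {q : ℝ} (h0 : 0 ≤ q) (h1 : q ≤ 1)
    (f : Fin K × (Fin K → Fin T → Bool) → ℝ) :
    ∫ x, f x ∂(jointBitsLaw K T q) =
      (K : ℝ)⁻¹ * ∑ a, ∑ b, bitsLikelihood q a b * f (a, b) := by
  unfold jointBitsLaw
  rw [Measure.sum_fintype, integral_finsetSum_measure]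
  · rw [← Fintype.sum_prod_type', Finset.mul_sum]
    refine Finset.sum_congr rfl fun x _ => ?_
    rw [integral_smul_measure, integral_dirac, smul_eq_mul, ENNReal.toReal_mul,
      ENNReal.toReal_inv, ENNReal.toReal_natCast, mul_assoc, ENNReal.toReal_prod]
    simp only [ENNReal.toReal_prod, bitsLikelihood]
    congr 2
    refine Finset.prod_congr rfl fun i _ => Finset.prod_congr rfl fun t _ => ?_
    exact ENNReal.toReal_ofReal (bitProb_nonneg h0 h1 x.1 i (x.2 i t))
  · intro x _
    have hK : (K : ENNReal) ≠ 0 := by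
      have := x.1.pos
      exact_mod_cast this.ne'
    refine Integrable.smul_measure (integrable_dirac (by simp)) ?_
    refine ENNReal.mul_ne_top (ENNReal.inv_ne_top.2 hK) ?_
    exact ENNReal.prod_ne_top fun i _ => ENNReal.prod_ne_top fun t _ => ENNReal.ofReal_ne_top

/-- The average success probability of a randomized predictor, bounded by a second moment. -/
theorem success_le {K T : ℕ} {M : ℝ} (hM : 0 < M) (η : ℝ)
    (p : (Fin K → Fin T → Bool) → Fin K → ℝ) (hp : ∀ b a, 0 ≤ p b a) (hp1 : ∀ b, ∑ a, p b a = 1) :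
    ∑ a, ∑ b, bitsLikelihood (1 / 2 - η) a b * p b a ≤
      M + K * (1 + 4 * η ^ 2) ^ T / (4 * M) := by
  set u : ℝ := ∏ _i : Fin K, ∏ _t : Fin T, (1 / 2 : ℝ) with hu
  have hle : ∀ a b, bitsLikelihood (1 / 2 - η) a b * p b a ≤ M * u * p b a +
      (∏ i, ∏ t, 2 * bitProb (1 / 2 - η) a i (b i t) ^ 2) / (4 * M) := by
    intro a b
    have hpa : p b a ≤ 1 :=
      hp1 b ▸ Finset.single_le_sum (fun i _ => hp b i) (Finset.mem_univ a)
    have hs : 0 ≤ (∏ i, ∏ t, 2 * bitProb (1 / 2 - η) a i (b i t) ^ 2) / (4 * M) := by positivity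
    have h := mul_le_mul_of_nonneg_right (bitsLikelihood_le hM (1 / 2 - η) a b) (hp b a)
    rw [add_mul] at h
    exact h.trans (add_le_add_right (mul_le_of_le_one_right hs hpa) _)
  have hu1 : ∑ _b : Fin K → Fin T → Bool, u = 1 := by
    rw [hu, sum_prod_bits (T := T) fun (_ : Fin K) _ => (1 / 2 : ℝ)]
    norm_num
  calc ∑ a, ∑ b, bitsLikelihood (1 / 2 - η) a b * p b a
      ≤ ∑ a, ∑ b, (M * u * p b a +
          (∏ i, ∏ t, 2 * bitProb (1 / 2 - η) a i (b i t) ^ 2) / (4 * M)) :=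
        Finset.sum_le_sum fun a _ => Finset.sum_le_sum fun b _ => hle a b
    _ = M + K * (1 + 4 * η ^ 2) ^ T / (4 * M) := by
        simp only [Finset.sum_add_distrib, ← Finset.sum_div, sum_sq_bitsLikelihood]
        congr 1
        · rw [Finset.sum_comm]
          simp only [← Finset.mul_sum, hp1, mul_one, hu1]
        · simp

theorem one_add_pow_le_half {K η : ℝ} {T : ℕ} (hK0 : 0 < K) (hK : 18 ≤ Real.log K)
    (hη : 36 * (T * η ^ 2) ≤ Real.log K) : (1 + 4 * η ^ 2) ^ T ≤ K / 2 := by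
  have h1 : (1 + 4 * η ^ 2) ^ T ≤ Real.exp (T * (4 * η ^ 2)) := by
    rw [Real.exp_nat_mul]
    gcongr
    linarith [Real.add_one_le_exp (4 * η ^ 2)]
  have h2 : Real.exp (T * (4 * η ^ 2)) * Real.exp 1 ≤ K := by
    rw [← Real.exp_add, ← Real.le_log_iff_exp_le hK0]
    linarith
  have h3 : 2 ≤ Real.exp 1 := by linarith [Real.add_one_le_exp 1]
  nlinarith [Real.exp_pos (T * (4 * η ^ 2))]

/-- in the "predicting the best action" problem, any (possibly randomized)
prediction rule `pred`, mapping the counts `C_{1,T},…,C_{K,T}` to a probability distribution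
over actions, errs with probability at least `1/4`:  `E[1 - pred(C)(i*)] ≥ 1/4`. -/
theorem predict_best_action_lower_bound (K T : ℕ) (hK2 : 2 ≤ K) (ε δ : ℝ)
    (hε : ε ∈ Set.Ioo (0 : ℝ) (1 / 2))
    (hK : (18 : ℝ) ≤ Real.log K) (hT : 2 * Real.log K ≤ (T : ℝ))
    (hδ : δ = min (1 / (6 * ε) * Real.sqrt (Real.log K / T)) (1 / 2))
    (pred : (Fin K → ℕ) → Fin K → ℝ)
    (hnonneg : ∀ cnt i, 0 ≤ pred cnt i)
    (hsum : ∀ cnt, ∑ i, pred cnt i = 1) :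
    (1 / 4 : ℝ) ≤
      ∫ x, (1 - pred (fun i => (Finset.univ.filter fun t => x.2 i t = true).card) x.1)
        ∂(jointBitsLaw K T (1 / 2 - ε * δ)) := by
  obtain ⟨hε0, hε1⟩ := hε
  have hK0 : (0 : ℝ) < K := by exact_mod_cast (by lia : 0 < K)
  have hT0 : (0 : ℝ) < T := by linarith
  have hδ0 : 0 ≤ δ := by
    rw [hδ]
    positivity
  have hδ1 : δ ≤ 1 / 2 := hδ ▸ min_le_right _ _
  set η := ε * δ with hη
  have hη0 : 0 ≤ η := by positivity
  have hη1 : η ≤ 1 / 4 := by nlinarith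
  have hη2 : 6 * η ≤ Real.sqrt (Real.log K / T) := by
    have h := mul_le_mul_of_nonneg_left (hδ ▸ min_le_left _ _ :
      δ ≤ 1 / (6 * ε) * Real.sqrt (Real.log K / T)) hε0.le
    calc 6 * η ≤ 6 * (ε * (1 / (6 * ε) * Real.sqrt (Real.log K / T))) := by linarith
      _ = Real.sqrt (Real.log K / T) := by field_simp
  have hη3 : 36 * (T * η ^ 2) ≤ Real.log K := by
    have h := pow_le_pow_left₀ (by positivity) hη2 2
    rw [Real.sq_sqrt (by positivity), le_div_iff₀ hT0] at h
    linarith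
  have hpow := one_add_pow_le_half hK0 hK hη3
  rw [integral_jointBitsLaw (by linarith) (by linarith)]
  have hsucc := success_le (T := T) (M := K / 4) (by positivity) η
    (fun b => pred fun i => (Finset.univ.filter fun t => b i t = true).card)
    (fun _ _ => hnonneg _ _) (fun _ => hsum _)
  simp only [mul_sub, mul_one, Finset.sum_sub_distrib, sum_bitsLikelihood]
  have hbound : (K : ℝ) / 4 + K * (1 + 4 * η ^ 2) ^ T / (4 * (K / 4)) ≤ 3 / 4 * K := by
    have : (K : ℝ) * (1 + 4 * η ^ 2) ^ T / (4 * (K / 4)) = (1 + 4 * η ^ 2) ^ T := by field_simp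
    linarith
  rw [← mul_sub, inv_mul_eq_div, le_div_iff₀ hK0]
  simp only [Finset.sum_const, Finset.card_univ, Fintype.card_fin, nsmul_eq_mul, mul_one]
  linarith
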